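/- arXiv:1706.03844 — 4 statements merged into one kernel-verified Lean document; each statement's English description precedes it below -/
import Mathlib

section
/- Let G be a discrete group, Λ ⊆ G, H a complex Hilbert space, 0 < ε < 1 and c > 0. Assume that for every z : Λ → (H →L[ℂ] H) with sup_{t∈Λ} ‖z t‖ ≤ 1 there exist a complex Hilbert space Ĥ₀, a unitary representation π₀ of G on Ĥ₀ and operators ξ₀, η₀ : H →L[ℂ] Ĥ₀ with ‖ξ₀‖·‖η₀‖ ≤ c such that sup_{t∈Λ} ‖z t − (adjoint η₀) ∘ π₀(t) ∘ ξ₀‖ ≤ ε. Then for every z : Λ → (H →L[ℂ] H) with sup_{t∈Λ} ‖z t‖ ≤ 1 there exist a complex Hilbert space Ĥ, a unitary representation π of G on Ĥ and operators ξ, η : H →L[ℂ] Ĥ with ‖ξ‖·‖η‖ ≤ c/(1−ε) such that (adjoint η) ∘ π(t) ∘ ξ = z t for every t ∈ Λ. -/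
open scoped ENNReal

section Helpers

variable {K : ℕ → Type} [∀ n, NormedAddCommGroup (K n)] [∀ n, InnerProductSpace ℂ (K n)]

theorem aux_memlp_iff (f : ∀ n, K n) : Memℓp f 2 ↔ Summable fun n => ‖f n‖ ^ 2 := by
  rw [memℓp_gen_iff (by norm_num)]
  simp

theorem aux_norm_sq (f : lp K 2) : ‖f‖ ^ 2 = ∑' n, ‖f n‖ ^ 2 := by
  have := lp.norm_rpow_eq_tsum (p := 2) (by norm_num) f
  simpa using this

/-- Direct sum of a family of isometries. -/
noncomputable def auxIso (e : ∀ n, K n ≃ₗᵢ[ℂ] K n) : lp K 2 →ₗᵢ[ℂ] lp K 2 where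
  toFun f := ⟨fun n => e n (f n), by
    have h : Memℓp (fun n => e n (f n)) 2 := by
      rw [aux_memlp_iff]
      simpa using (aux_memlp_iff _).1 (lp.memℓp f)
    exact h⟩
  map_add' f g := by
    ext n
    simp
    rfl
  map_smul' a f := by
    ext n
    simp
  norm_map' f := by
    rw [← sq_eq_sq₀ (norm_nonneg _) (norm_nonneg _), aux_norm_sq, aux_norm_sq]
    simp

@[simp] theorem auxIso_apply (e : ∀ n, K n ≃ₗᵢ[ℂ] K n) (f : lp K 2) (n : ℕ) :
    auxIso e f n = e n (f n) := rfl

/-- Direct sum of a family of isometric equivalences. -/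
noncomputable def auxEquiv (e : ∀ n, K n ≃ₗᵢ[ℂ] K n) : lp K 2 ≃ₗᵢ[ℂ] lp K 2 where
  toFun := auxIso e
  invFun := auxIso (fun n => (e n).symm)
  left_inv f := by
    ext n
    simp
  right_inv f := by
    ext n
    simp
  map_add' := (auxIso e).map_add
  map_smul' := (auxIso e).map_smul
  norm_map' := (auxIso e).norm_map

@[simp] theorem auxEquiv_apply (e : ∀ n, K n ≃ₗᵢ[ℂ] K n) (f : lp K 2) (n : ℕ) :
    auxEquiv e f n = e n (f n) := rfl

variable [∀ n, CompleteSpace (K n)]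

/-- Direct sum of unitary representations. -/
noncomputable def auxRep {G : Type} [Group G] (π : ∀ n, G →* unitary (K n →L[ℂ] K n)) :
    G →* unitary (lp K 2 →L[ℂ] lp K 2) :=
  (Unitary.linearIsometryEquiv (𝕜 := ℂ) (H := lp K 2)).symm.toMonoidHom.comp
    { toFun := fun g => auxEquiv fun n => Unitary.linearIsometryEquiv (π n g)
      map_one' := by
        ext f n
        simp
      map_mul' := fun g h => by
        ext f n
        simp }

theorem auxRep_apply {G : Type} [Group G] (π : ∀ n, G →* unitary (K n →L[ℂ] K n)) (g : G)
    (f : lp K 2) (n : ℕ) :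
    (auxRep π g : lp K 2 →L[ℂ] lp K 2) f n = (π n g : K n →L[ℂ] K n) (f n) := by
  simp [auxRep]
  rfl

variable {H : Type} [NormedAddCommGroup H] [InnerProductSpace ℂ H]

theorem aux_col (ξ : ∀ n, H →L[ℂ] K n) (C : ℝ) (a : ℕ → ℝ) (ha : HasSum a C)
    (h : ∀ n, ‖ξ n‖ ^ 2 ≤ a n) :
    ∃ Ξ : H →L[ℂ] lp K 2, ‖Ξ‖ ≤ √C ∧ ∀ x n, Ξ x n = ξ n x := by
  have hb : ∀ x n, ‖ξ n x‖ ^ 2 ≤ a n * ‖x‖ ^ 2 := fun x n => by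
    calc ‖ξ n x‖ ^ 2 ≤ (‖ξ n‖ * ‖x‖) ^ 2 := by gcongr; exact (ξ n).le_opNorm x
      _ = ‖ξ n‖ ^ 2 * ‖x‖ ^ 2 := by ring
      _ ≤ _ := by gcongr; exact h n
  have hs : ∀ x, Summable fun n => ‖ξ n x‖ ^ 2 := fun x =>
    Summable.of_nonneg_of_le (fun _ => by positivity) (hb x) (ha.mul_right _).summable
  let L : H →ₗ[ℂ] lp K 2 :=
    { toFun := fun x => ⟨fun n => ξ n x, (aux_memlp_iff (fun n => ξ n x)).2 (hs x)⟩
      map_add' := fun x y => by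
        ext n
        simp
        rfl
      map_smul' := fun c x => by
        ext n
        simp }
  have hC : 0 ≤ C := ha.nonneg fun n => (sq_nonneg _).trans (h n)
  refine ⟨L.mkContinuous (√C) fun x => ?_, L.mkContinuous_norm_le (Real.sqrt_nonneg _) _,
    fun x n => rfl⟩
  refine (sq_le_sq₀ (norm_nonneg _) (by positivity)).1 ?_
  rw [aux_norm_sq, mul_pow, Real.sq_sqrt hC]
  exact hasSum_le (hb x) (hs x).hasSum (ha.mul_right _)

end Helpers

theorem aux_balance {H K : Type} [NormedAddCommGroup H] [InnerProductSpace ℂ H] [CompleteSpace H]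
    [NormedAddCommGroup K] [InnerProductSpace ℂ K] [CompleteSpace K] (c : ℝ) (hc : 0 < c)
    (ξ η : H →L[ℂ] K) (h : ‖ξ‖ * ‖η‖ ≤ c) :
    ∃ ξ' η' : H →L[ℂ] K, ‖ξ'‖ ^ 2 ≤ c ∧ ‖η'‖ ^ 2 ≤ c ∧
      ∀ (u : K →L[ℂ] K) x y, inner ℂ (η' x) (u (ξ' y)) = inner ℂ (η x) (u (ξ y)) := by
  by_cases h0 : ξ = 0 ∨ η = 0
  · refine ⟨0, 0, by simpa using hc.le, by simpa using hc.le, fun u x y => ?_⟩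
    rcases h0 with rfl | rfl <;> simp
  push Not at h0
  have h1 : 0 < ‖ξ‖ := norm_pos_iff.2 h0.1
  have h2 : 0 < ‖η‖ := norm_pos_iff.2 h0.2
  have hq : 0 < ‖η‖ / ‖ξ‖ := by positivity
  have ha : 0 < √(‖η‖ / ‖ξ‖) := Real.sqrt_pos.2 hq
  have ha2 : √(‖η‖ / ‖ξ‖) ^ 2 = ‖η‖ / ‖ξ‖ := Real.sq_sqrt hq.le
  generalize √(‖η‖ / ‖ξ‖) = a at ha ha2
  refine ⟨(a : ℂ) • ξ, ((a⁻¹ : ℝ) : ℂ) • η, ?_, ?_, fun u x y => ?_⟩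
  · rw [norm_smul, mul_pow, Complex.norm_real, Real.norm_of_nonneg ha.le, ha2]
    refine le_of_eq_of_le ?_ h
    field_simp
  · rw [norm_smul, mul_pow, Complex.norm_real, Real.norm_of_nonneg (by positivity), inv_pow, ha2]
    refine le_of_eq_of_le ?_ h
    field_simp
  · have : (a : ℂ) ≠ 0 := by exact_mod_cast ha.ne'
    simp only [smul_apply, map_smul, inner_smul_left, inner_smul_right,
      Complex.conj_ofReal]
    push_cast
    field_simp

theorem interpolation_of_approximate_interpolation {G : Type} [Group G] (Λ : Set G)
    {H : Type} [NormedAddCommGroup H] [InnerProductSpace ℂ H] [CompleteSpace H]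
    (ε : ℝ) (hε₀ : 0 < ε) (hε₁ : ε < 1) (c : ℝ) (hc : 0 < c)
    (hyp : ∀ z : ↥Λ → H →L[ℂ] H, (∀ t, ‖z t‖ ≤ 1) →
      ∃ (K₀ : Type) (_ : NormedAddCommGroup K₀) (_ : InnerProductSpace ℂ K₀)
        (_ : CompleteSpace K₀) (π₀ : G →* unitary (K₀ →L[ℂ] K₀)) (ξ₀ η₀ : H →L[ℂ] K₀),
        ‖ξ₀‖ * ‖η₀‖ ≤ c ∧
        ∀ t : ↥Λ,
          ‖z t - (ContinuousLinearMap.adjoint η₀).comp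
            (((π₀ (t : G) : unitary (K₀ →L[ℂ] K₀)) : K₀ →L[ℂ] K₀).comp ξ₀)‖ ≤ ε) :
    ∀ z : ↥Λ → H →L[ℂ] H, (∀ t, ‖z t‖ ≤ 1) →
      ∃ (K : Type) (_ : NormedAddCommGroup K) (_ : InnerProductSpace ℂ K) (_ : CompleteSpace K)
        (π : G →* unitary (K →L[ℂ] K)) (ξ η : H →L[ℂ] K),
        ‖ξ‖ * ‖η‖ ≤ c / (1 - ε) ∧
        ∀ t : ↥Λ,
          (ContinuousLinearMap.adjoint η).comp
            (((π (t : G) : unitary (K →L[ℂ] K)) : K →L[ℂ] K).comp ξ) = z t := by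
  intro z hz
  have hstep : ∀ z : {z : ↥Λ → H →L[ℂ] H // ∀ t, ‖z t‖ ≤ 1},
      ∃ (K₀ : Type) (_ : NormedAddCommGroup K₀) (_ : InnerProductSpace ℂ K₀)
        (_ : CompleteSpace K₀) (π₀ : G →* unitary (K₀ →L[ℂ] K₀)) (ξ₀ η₀ : H →L[ℂ] K₀)
        (z' : {z : ↥Λ → H →L[ℂ] H // ∀ t, ‖z t‖ ≤ 1}),
        ‖ξ₀‖ ^ 2 ≤ c ∧ ‖η₀‖ ^ 2 ≤ c ∧
        ∀ t : ↥Λ, ∀ x y, inner ℂ (η₀ x) ((π₀ (t : G) : K₀ →L[ℂ] K₀) (ξ₀ y))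
          = inner ℂ x (z.1 t y) - ε * inner ℂ x (z'.1 t y) := by
    rintro ⟨z, hz⟩
    obtain ⟨K₀, i1, i2, i3, π₀, ξ₀, η₀, h1, h2⟩ := hyp z hz
    obtain ⟨ξ, η, hξ, hη, h3⟩ := aux_balance c hc ξ₀ η₀ h1
    refine ⟨K₀, i1, i2, i3, π₀, ξ, η, ⟨fun t => ((ε⁻¹ : ℝ) : ℂ) •
      (z t - (ContinuousLinearMap.adjoint η₀).comp
            (((π₀ (t : G) : unitary (K₀ →L[ℂ] K₀)) : K₀ →L[ℂ] K₀).comp ξ₀)), fun t => ?_⟩,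
      hξ, hη, fun t x y => ?_⟩
    · rw [norm_smul, Complex.norm_real, Real.norm_of_nonneg (by positivity),
        inv_mul_le_iff₀ hε₀, mul_one]
      exact h2 t
    · have : (ε : ℂ) ≠ 0 := by exact_mod_cast hε₀.ne'
      rw [h3]
      simp [inner_smul_right, inner_sub_right, ContinuousLinearMap.adjoint_inner_right, this]
  choose K i1 i2 i3 π ξ η z' h1 h2 h3 using hstep
  let s : ℕ → {z : ↥Λ → H →L[ℂ] H // ∀ t, ‖z t‖ ≤ 1} := fun n => z'^[n] ⟨z, hz⟩
  have hs : ∀ n, s (n + 1) = z' (s n) := fun n => Function.iterate_succ_apply' _ _ _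
  have hr : ∀ n, √ε ^ n * √ε ^ n = ε ^ n := fun n => by
    rw [← mul_pow, Real.mul_self_sqrt hε₀.le]
  have hsum : HasSum (fun n => ε ^ n * c) (c / (1 - ε)) := by
    have := (hasSum_geometric_of_lt_one hε₀.le hε₁).mul_right c
    rwa [inv_mul_eq_div] at this
  have hscale : ∀ n (T : H →L[ℂ] K (s n)), ‖T‖ ^ 2 ≤ c →
      ‖((√ε ^ n : ℝ) : ℂ) • T‖ ^ 2 ≤ ε ^ n * c := fun n T hT => by
    rw [norm_smul, mul_pow, Complex.norm_real, Real.norm_of_nonneg (by positivity), sq, hr]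
    gcongr
  obtain ⟨Ξ, hΞ, hΞ'⟩ := aux_col (K := fun n => K (s n))
    (fun n => ((√ε ^ n : ℝ) : ℂ) • ξ (s n)) _ _ hsum (fun n => hscale n _ (h1 _))
  obtain ⟨E, hE, hE'⟩ := aux_col (K := fun n => K (s n))
    (fun n => ((√ε ^ n : ℝ) : ℂ) • η (s n)) _ _ hsum (fun n => hscale n _ (h2 _))
  have hC : 0 ≤ c / (1 - ε) := div_nonneg hc.le (by linarith)
  refine ⟨lp (fun n => K (s n)) 2, inferInstance, inferInstance, inferInstance,
    auxRep (fun n => π (s n)), Ξ, E, ?_, fun t => ?_⟩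
  · calc ‖Ξ‖ * ‖E‖ ≤ √(c / (1 - ε)) * √(c / (1 - ε)) := by gcongr
      _ = _ := Real.mul_self_sqrt hC
  ext y
  refine ext_inner_left ℂ fun x => ?_
  rw [ContinuousLinearMap.comp_apply, ContinuousLinearMap.adjoint_inner_right,
    ContinuousLinearMap.comp_apply]
  have hS := lp.hasSum_inner (𝕜 := ℂ) (E x)
    ((auxRep (fun n => π (s n)) (t : G) : lp (fun n => K (s n)) 2 →L[ℂ] lp (fun n => K (s n)) 2) (Ξ y))
  have hterm : ∀ n, inner ℂ (E x n)
      ((auxRep (fun n => π (s n)) (t : G) : lp (fun n => K (s n)) 2 →L[ℂ] lp (fun n => K (s n)) 2) (Ξ y) n)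
      = (ε : ℂ) ^ n * inner ℂ x ((s n).1 t y)
        - (ε : ℂ) ^ (n + 1) * inner ℂ x ((s (n + 1)).1 t y) := fun n => by
    have hr' : ((√ε ^ n : ℝ) : ℂ) * ((√ε ^ n : ℝ) : ℂ) = (ε : ℂ) ^ n := by
      exact_mod_cast congrArg (fun r : ℝ => (r : ℂ)) (hr n)
    rw [auxRep_apply, hΞ', hE', hs]
    simp only [smul_apply, map_smul, inner_smul_left, inner_smul_right,
      Complex.conj_ofReal, h3]
    rw [← mul_assoc, hr']
    ring
  simp only [hterm] at hS
  have hT := hS.tendsto_sum_nat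
  simp only [Finset.sum_range_sub'] at hT
  have h0 : Filter.Tendsto (fun n => (ε : ℂ) ^ n * inner ℂ x ((s n).1 t y)) Filter.atTop
      (nhds 0) := by
    refine squeeze_zero_norm (a := fun n => ε ^ n * (‖x‖ * ‖y‖)) (fun n => ?_) ?_
    · rw [norm_mul, norm_pow, Complex.norm_real, Real.norm_of_nonneg hε₀.le]
      gcongr
      refine (norm_inner_le_norm _ _).trans ?_
      gcongr
      exact ((s n).1 t).le_of_opNorm_le ((s n).2 t) y |>.trans_eq (one_mul _)
    · simpa using (tendsto_pow_atTop_nhds_zero_of_lt_one hε₀.le hε₁).mul_const (‖x‖ * ‖y‖)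
  have hT' := (h0.const_sub ((ε : ℂ) ^ 0 * inner ℂ x ((s 0).1 t y)))
  have := tendsto_nhds_unique hT hT'
  simpa [s] using this
end

section
/- Let G be a discrete group, A a unital C*-algebra, and let φ : G → A be completely positive definite. Define ψ : G → A by ψ(t) = φ(t) for t ≠ 1 and ψ(1) = ‖φ(1)‖ • (1 : A). Then ψ is completely positive definite, and ψ(1) − φ(1) is nonnegative in A. -/
/-- An `A`-valued function on a group is completely positive definite: for every `n` and
`t : Fin n → G`, the matrix `(f ((t i)⁻¹ * t j))` is a nonnegative element of the
C*-algebra of `n × n` matrices over `A`, i.e. of the form `Bᴴ * B`. -/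
def IsCompletelyPosDefFn {G A : Type} [Group G] [CStarAlgebra A] (f : G → A) : Prop :=
  ∀ (n : ℕ) (t : Fin n → G), ∃ B : Matrix (Fin n) (Fin n) A,
    Matrix.of (fun i j : Fin n => f ((t i)⁻¹ * t j)) = B.conjTranspose * B

/-- In a C*-algebra, a sum of two elements of the form `star a * a` is again of this form. -/
theorem exists_star_mul_self_add {M : Type} [CStarAlgebra M] (a b : M) :
    ∃ d : M, star a * a + star b * b = star d * d := by
  let _ : PartialOrder M := CStarAlgebra.spectralOrder M
  have _ : StarOrderedRing M := CStarAlgebra.spectralOrderedRing M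
  exact CStarAlgebra.nonneg_iff_eq_star_mul_self.mp
    (add_nonneg (star_mul_self_nonneg a) (star_mul_self_nonneg b))

theorem completelyPosDef_modify_at_one {G : Type} [Group G] (A : Type) [CStarAlgebra A]
    (φ : G → A) (hφ : IsCompletelyPosDefFn φ)
    (ψ : G → A) (hψ_ne : ∀ t : G, t ≠ 1 → ψ t = φ t) (hψ_one : ψ 1 = ‖φ 1‖ • (1 : A)) :
    IsCompletelyPosDefFn ψ ∧ ∃ y : A, ψ 1 - φ 1 = star y * y := by
  classical
  let _ : PartialOrder A := CStarAlgebra.spectralOrder A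
  have _ : StarOrderedRing A := CStarAlgebra.spectralOrderedRing A
  have hy : ∃ y : A, ψ 1 - φ 1 = star y * y := by
    obtain ⟨B, hB⟩ := hφ 1 (fun _ => 1)
    have h1 : φ 1 = star (B 0 0) * B 0 0 := by
      have := congrFun (congrFun hB 0) 0
      simpa [Matrix.mul_apply] using this
    have hsa : IsSelfAdjoint (φ 1) := by
      rw [h1]; exact IsSelfAdjoint.star_mul_self _
    have h2 : φ 1 ≤ ψ 1 := by
      rw [hψ_one, ← Algebra.algebraMap_eq_smul_one]
      exact hsa.le_algebraMap_norm_self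
    exact CStarAlgebra.nonneg_iff_eq_star_mul_self.mp (sub_nonneg.mpr h2)
  refine ⟨?_, hy⟩
  obtain ⟨y, hy⟩ := hy
  intro n t
  obtain ⟨B, hB⟩ := hφ n t
  let r : Fin n → Fin n := fun i => Set.rangeSplitting t ⟨t i, i, rfl⟩
  have hr : ∀ i j, r i = r j ↔ t i = t j := by
    intro i j
    have ht : ∀ i, t (r i) = t i := fun i => Set.apply_rangeSplitting t ⟨t i, i, rfl⟩
    constructor
    · intro h
      rw [← ht i, ← ht j, h]
    · intro h
      simp only [r, h]
  let C : CStarMatrix (Fin n) (Fin n) A :=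
    CStarMatrix.ofMatrix (Matrix.of fun k j => if k = r j then y else 0)
  let B' : CStarMatrix (Fin n) (Fin n) A := CStarMatrix.ofMatrix B
  obtain ⟨D, hD⟩ : ∃ D : CStarMatrix (Fin n) (Fin n) A,
      star B' * B' + star C * C = star D * D := exists_star_mul_self_add B' C
  refine ⟨CStarMatrix.ofMatrix.symm D, ?_⟩
  have hD' : B.conjTranspose * B + CStarMatrix.ofMatrix.symm (star C * C)
      = (CStarMatrix.ofMatrix.symm D).conjTranspose * CStarMatrix.ofMatrix.symm D := hD
  rw [← hD', ← hB]
  ext i j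
  have hC : (star C * C) i j = if t i = t j then star y * y else 0 := by
    rw [CStarMatrix.mul_apply]
    simp only [CStarMatrix.star_apply, C, CStarMatrix.ofMatrix_apply, Matrix.of_apply]
    rw [Finset.sum_eq_single (r j)]
    · by_cases h : t i = t j
      · simp [h, (hr i j).2 h]
      · have : ¬ r j = r i := fun h' => h ((hr i j).1 h'.symm)
        simp [h, this]
    · intro k _ hk
      simp [hk]
    · simp
  have hadd : (Matrix.of (fun i j : Fin n => φ ((t i)⁻¹ * t j))
      + CStarMatrix.ofMatrix.symm (star C * C)) i j
      = φ ((t i)⁻¹ * t j) + (star C * C) i j := rfl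
  refine Eq.trans ?_ hadd.symm
  rw [hC]
  by_cases h : t i = t j
  · simp [h, ← hy]
  · have : (t i)⁻¹ * t j ≠ 1 := fun h' => h (inv_mul_eq_one.mp h')
    simp [h, hψ_ne _ this]
end

section
/- Let Λ be a set and let |γ| denote the length of the reduced word of an element γ of the free group FreeGroup Λ. For every real ε with −1 ≤ ε ≤ 1, the function h_ε : FreeGroup Λ → ℂ defined by h_ε(γ) = ε^{|γ|} (with the convention ε⁰ = 1, so h_ε(1) = 1) is positive definite on FreeGroup Λ: for every n and every γ : Fin n → FreeGroup Λ, the complex matrix with (i,j) entry ε^{|(γ i)⁻¹ * (γ j)|} is positive semidefinite. -/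
/-- Weight of the prefix `w` in the word `u`. -/
def hgF {A : Type} [DecidableEq A] (e : ℝ) (w u : List A) : ℝ :=
  if w <+: u then e ^ (u.length - w.length) else 0

theorem hgF_cons {A : Type} [DecidableEq A] (e : ℝ) (a b : A) (w u : List A) :
    hgF e (a :: w) (b :: u) = if a = b then hgF e w u else 0 := by
  unfold hgF
  by_cases h : a = b <;> simp [h, List.cons_prefix_cons]

theorem hg_key {Λ : Type} [DecidableEq Λ] (e : ℝ) (u v : List (Λ × Bool))
    (hu : FreeGroup.IsReduced u) (hv : FreeGroup.IsReduced v) :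
    e ^ (FreeGroup.reduce (FreeGroup.invRev u ++ v)).length =
      e ^ 2 * (e ^ u.length * e ^ v.length) +
        (u.inits.map fun w => (1 - e ^ 2) * (hgF e w u * hgF e w v)).sum := by
  induction u generalizing v with
  | nil =>
    simp [FreeGroup.invRev, hv.reduce_eq, hgF]
    ring
  | cons a u ih =>
    have hinv : FreeGroup.IsReduced (FreeGroup.invRev (a :: u)) := by
      rw [FreeGroup.isReduced_iff_reduce_eq, FreeGroup.reduce_invRev, hu.reduce_eq]
    have hcons : FreeGroup.invRev (a :: u) = FreeGroup.invRev u ++ [(a.1, !a.2)] := by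
      simp [FreeGroup.invRev]
    cases v with
    | nil =>
      rw [List.append_nil, hinv.reduce_eq, FreeGroup.invRev_length]
      simp [hgF, Function.comp_def]
      ring
    | cons b v =>
      simp only [List.inits_cons, List.map_cons, List.map_map, List.sum_cons, Function.comp_def,
        hgF_cons]
      by_cases h : a = b
      · subst h
        have hred : FreeGroup.reduce (FreeGroup.invRev (a :: u) ++ a :: v)
            = FreeGroup.reduce (FreeGroup.invRev u ++ v) := by
          apply FreeGroup.reduce.Step.eq
          rw [hcons]
          have := FreeGroup.Red.Step.not (L₁ := FreeGroup.invRev u) (L₂ := v) (x := a.1)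
            (b := !a.2)
          simpa using this
        rw [hred, ih v (hu.infix (List.suffix_cons a u).isInfix)
          (hv.infix (List.suffix_cons a v).isInfix)]
        simp [hgF]
        ring
      · have hr : FreeGroup.IsReduced (FreeGroup.invRev (a :: u) ++ b :: v) := by
          rw [hcons]
          refine FreeGroup.IsReduced.append_overlap (hcons ▸ hinv) ?_ (by simp)
          simp only [List.singleton_append, FreeGroup.isReduced_cons_cons]
          refine ⟨fun h1 => ?_, hv⟩
          have : a.2 ≠ b.2 := fun h2 => h (Prod.ext h1 h2)
          revert this
          cases a.2 <;> cases b.2 <;> simp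
        rw [hr.reduce_eq, List.length_append, FreeGroup.invRev_length]
        simp [h, hgF]
        ring

theorem hg_nodup {A : Type} (u : List A) : u.inits.Nodup := by
  induction u with
  | nil => simp
  | cons a u ih =>
    rw [List.inits_cons, List.nodup_cons]
    exact ⟨by simp, ih.map (List.cons_injective)⟩

theorem hg_key' {Λ : Type} [DecidableEq Λ] (e : ℝ) (u v : List (Λ × Bool))
    (hu : FreeGroup.IsReduced u) (hv : FreeGroup.IsReduced v)
    (T : Finset (List (Λ × Bool))) (hT : u.inits.toFinset ⊆ T) :
    e ^ (FreeGroup.reduce (FreeGroup.invRev u ++ v)).length =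
      e ^ 2 * (e ^ u.length * e ^ v.length) +
        ∑ w ∈ T, (1 - e ^ 2) * (hgF e w u * hgF e w v) := by
  rw [hg_key e u v hu hv, ← Finset.sum_subset hT, List.sum_toFinset]
  · exact hg_nodup u
  · intro w _ hw
    have : ¬ w <+: u := by simpa using hw
    simp [hgF, this]

open scoped ComplexOrder in
theorem haagerup_posDef (Λ : Type) [DecidableEq Λ] (ε : ℝ) (hε₀ : -1 ≤ ε) (hε₁ : ε ≤ 1) :
    ∀ (n : ℕ) (γ : Fin n → FreeGroup Λ),
      (Matrix.of fun i j : Fin n =>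
        ((ε : ℂ) ^ (FreeGroup.toWord ((γ i)⁻¹ * γ j)).length)).PosSemidef := by
  intro n γ
  let T : Finset (List (Λ × Bool)) := Finset.univ.biUnion fun i => (γ i).toWord.inits.toFinset
  obtain ⟨V, hV, hVa⟩ : ∃ V : (List (Λ × Bool) → ℝ) → Matrix (Fin n) (Fin n) ℂ,
      (∀ f, (V f).PosSemidef) ∧
      ∀ f i j, V f i j = ((f (γ i).toWord * f (γ j).toWord : ℝ) : ℂ) :=
    ⟨fun f => Matrix.vecMulVec (fun i => (f (γ i).toWord : ℂ))
      (star fun i => (f (γ i).toWord : ℂ)),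
      fun f => Matrix.posSemidef_vecMulVec_self_star _,
      fun f i j => by simp [Matrix.vecMulVec_apply]⟩
  have hM : (Matrix.of fun i j : Fin n =>
        ((ε : ℂ) ^ (FreeGroup.toWord ((γ i)⁻¹ * γ j)).length)) =
      (ε ^ 2 : ℝ) • V (fun u => ε ^ u.length) + ∑ w ∈ T, (1 - ε ^ 2 : ℝ) • V (hgF ε w) := by
    ext i j
    have := hg_key' ε (γ i).toWord (γ j).toWord FreeGroup.isReduced_toWord
      FreeGroup.isReduced_toWord T
      (Finset.subset_biUnion_of_mem (fun i => (γ i).toWord.inits.toFinset) (Finset.mem_univ i))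
    rw [← FreeGroup.toWord_inv, ← FreeGroup.toWord_mul] at this
    rw [Matrix.of_apply, ← Complex.ofReal_pow, this]
    simp [hVa, Matrix.sum_apply]
  rw [hM]
  have h1 : (0 : ℝ) ≤ ε ^ 2 := sq_nonneg ε
  have h2 : (0 : ℝ) ≤ 1 - ε ^ 2 := by nlinarith
  have h3 : ((ε ^ 2 : ℝ) • V (fun u => ε ^ u.length)).PosSemidef := (hV _).smul h1
  have h4 (w) : ((1 - ε ^ 2 : ℝ) • V (hgF ε w)).PosSemidef := (hV _).smul h2
  exact h3.add (Matrix.posSemidef_sum _ fun w _ => h4 w)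
end

section
/- Let G be a discrete commutative group and let Λ ⊆ G \ {1} be a symmetric set (Λ⁻¹ = Λ) with no element of order 2, and let Λ₁ ⊆ Λ be such that Λ is the disjoint union of Λ₁ and Λ₁⁻¹. Then Λ is a Sidon set (i.e. there is κ such that ∑_{t} |a t| ≤ κ · sup_{χ} |∑_{t} (a t)·χ(t)| for every finitely supported a : Λ → ℂ, the supremum being over all group homomorphisms χ : G →* circle) if and only if there exists δ > 0 with the following property: for every c ∈ ℝ and every finitely supported a : Λ → ℂ with a(t⁻¹) = conj(a t) for all t ∈ Λ, if 0 ≤ (c + ∑_{t∈Λ} (a t)·χ(t)).re for every group homomorphism χ : G →* circle, then 0 ≤ (c + δ·∑_{t∈Λ₁} ((a t)·(z t) + (a t⁻¹)·conj(z t))).re for every function z : Λ₁ → circle. -/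
open MeasureTheory

lemma fz_exists_char {G : Type} [CommGroup G] {g : G} (hg : g ≠ 1) :
    ∃ χ : G →* Circle, χ g ≠ 1 := by
  have h0 : (Additive.ofMul g) ≠ 0 := hg
  obtain ⟨c, hc⟩ := CharacterModule.exists_character_apply_ne_zero_of_ne_zero h0
  let φ : AddCircle (1 : ℚ) →+ AddCircle (1 : ℝ) :=
    QuotientAddGroup.map _ _ (Rat.castHom ℝ).toAddMonoidHom (by
      intro x hx
      obtain ⟨n, rfl⟩ := AddSubgroup.mem_zmultiples_iff.1 hx
      exact AddSubgroup.mem_zmultiples_iff.2 ⟨n, by simp⟩)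
  have hφ : ∀ y, φ y = 0 → y = 0 := by
    intro y
    induction y using QuotientAddGroup.induction_on with
    | H x =>
      intro h
      have h2 : ((x : ℝ) : AddCircle (1 : ℝ)) = 0 := h
      obtain ⟨n, hn⟩ := (AddCircle.coe_eq_zero_iff _).1 h2
      refine (AddCircle.coe_eq_zero_iff (1 : ℚ)).2 ⟨n, ?_⟩
      have : ((n • (1 : ℚ) : ℚ) : ℝ) = x := by simpa using hn
      exact_mod_cast this
  let ψ : G →* Circle :=
    { toFun := fun x => AddCircle.toCircle (φ (c (Additive.ofMul x)))
      map_one' := by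
        have : c (Additive.ofMul (1:G)) = 0 := by rw [ofMul_one]; exact map_zero c
        simp
      map_mul' := fun x y => by
        have : c (Additive.ofMul (x * y)) = c (Additive.ofMul x) + c (Additive.ofMul y) := by
          rw [ofMul_mul]; exact map_add c _ _
        simp [AddCircle.toCircle_add] }
  refine ⟨ψ, fun h => hc (hφ _ ?_)⟩
  apply AddCircle.injective_toCircle one_ne_zero
  rw [AddCircle.toCircle_zero]
  exact h

lemma fz_exists_mean (G : Type) [CommGroup G] :
    ∃ (X : Type) (_ : TopologicalSpace X) (_ : CompactSpace X) (_ : MeasurableSpace X)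
      (_ : BorelSpace X) (μ : Measure X) (_ : IsProbabilityMeasure μ) (ev : X → (G →* Circle)),
      (∀ g, Continuous fun x => ev x g) ∧
      ∀ g, g ≠ 1 → ∫ x, ((ev x g : Circle) : ℂ) ∂μ = 0 := by
  classical
  let : TopologicalSpace G := ⊥
  have : DiscreteTopology G := ⟨rfl⟩
  let : MeasurableSpace (PontryaginDual G) := borel _
  have : BorelSpace (PontryaginDual G) := ⟨rfl⟩
  let K : TopologicalSpace.PositiveCompacts (PontryaginDual G) := ⊤
  let μ : Measure (PontryaginDual G) := Measure.haarMeasure K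
  have : IsProbabilityMeasure μ := ⟨by
    have := Measure.haarMeasure_self (K₀ := K)
    simpa [K] using this⟩
  let ev : PontryaginDual G → (G →* Circle) := fun x => MonoidHomClass.toMonoidHom x
  refine ⟨PontryaginDual G, inferInstance, inferInstance, inferInstance, inferInstance, μ,
    inferInstance, ev, ?_, ?_⟩
  · intro g
    exact ContinuousEvalConst.continuous_eval_const (F := ContinuousMonoidHom G Circle) g
  · intro g hg
    · obtain ⟨χ, hχ⟩ := fz_exists_char hg
      let χ' : PontryaginDual G := (⟨χ, continuous_of_discreteTopology⟩ : G →ₜ* Circle)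
      have h1 := integral_mul_left_eq_self (μ := μ) (fun x => ((ev x g : Circle) : ℂ)) χ'
      have h2 : ∀ x, ((ev (χ' * x) g : Circle) : ℂ) = (χ g : ℂ) * ((ev x g : Circle) : ℂ) :=
        fun x => by rw [← Circle.coe_mul]; rfl
      simp_rw [h2] at h1
      rw [integral_const_mul] at h1
      have h3 : ((χ g : ℂ) - 1) * ∫ x, ((ev x g : Circle) : ℂ) ∂μ = 0 := by
        rw [sub_mul, h1, one_mul, sub_self]
      rcases mul_eq_zero.1 h3 with h | h
      · exact absurd (Circle.ext (by simpa using sub_eq_zero.1 h)) hχ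
      · exact h

/-- The exponent attached to a digit. -/
def fzQ (d : Fin 3) : ℤ := (d.val : ℤ) - 1

/-- The monomial `u ^ m`. -/
noncomputable def fzMon {ι : Type} [Fintype ι] (u : ι → Circle) (m : ι → Fin 3) : Circle :=
  ∏ t, u t ^ fzQ (m t)

lemma fzMon_mul {ι : Type} [Fintype ι] (u v : ι → Circle) (m : ι → Fin 3) :
    fzMon (fun t => u t * v t) m = fzMon u m * fzMon v m := by
  simp [fzMon, mul_zpow, Finset.prod_mul_distrib]

/-- cube root of unity -/
noncomputable def fzZ : Circle := Circle.exp (2 * Real.pi / 3)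

lemma fzZ_prim : IsPrimitiveRoot (fzZ : ℂ) 3 := by
  have h := Complex.isPrimitiveRoot_exp 3 (by norm_num)
  have e : (fzZ : ℂ) = Complex.exp (2 * Real.pi * Complex.I / (3 : ℕ)) := by
    rw [fzZ, Circle.coe_exp]; congr 1; push_cast; ring
  rwa [e]

lemma fz_coe_prod {ι : Type} (s : Finset ι) (f : ι → Circle) :
    ((∏ t ∈ s, f t : Circle) : ℂ) = ∏ t ∈ s, (f t : ℂ) := map_prod Circle.coeHom f s

lemma fzZ_cube : fzZ ^ 3 = 1 := by
  apply Circle.ext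
  rw [Circle.coe_pow, fzZ_prim.pow_eq_one, Circle.coe_one]

lemma fzZ_sum : (1 : ℂ) + fzZ + (fzZ : ℂ) ^ 2 = 0 := by
  have h3 : (fzZ : ℂ) ^ 3 = 1 := by exact_mod_cast congrArg (Subtype.val) fzZ_cube
  have h1 : (fzZ : ℂ) ≠ 1 := fzZ_prim.ne_one (by norm_num)
  have : ((fzZ : ℂ) - 1) * (1 + fzZ + (fzZ : ℂ) ^ 2) = 0 := by linear_combination h3
  exact (mul_eq_zero.1 this).resolve_left (sub_ne_zero.2 h1)

/-- sample points -/
noncomputable def fzW {ι : Type} (k : ι → Fin 3) : ι → Circle := fun t => fzZ ^ (k t).val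

lemma fz_digit (d d' : Fin 3) :
    ∑ k : Fin 3, (((fzZ ^ k.val) ^ fzQ d : Circle) : ℂ) *
      (starRingEnd ℂ) (((fzZ ^ k.val) ^ fzQ d' : Circle) : ℂ) = if d = d' then 3 else 0 := by
  have h := fzZ_sum
  have h3 : (fzZ : ℂ) ^ 3 = 1 := by exact_mod_cast congrArg (Subtype.val) fzZ_cube
  have hi : ((fzZ : ℂ))⁻¹ = fzZ ^ 2 := by
    rw [inv_eq_iff_eq_inv]; apply eq_inv_of_mul_eq_one_left; linear_combination h3
  have h4 : (fzZ : ℂ) ^ 4 = fzZ := by linear_combination fzZ * h3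
  have hi2 : ((fzZ : ℂ))⁻¹ ^ 2 = fzZ := by rw [hi]; linear_combination h4
  have hi4 : ((fzZ : ℂ))⁻¹ ^ 4 = fzZ ^ 2 := by
    rw [show ((fzZ : ℂ))⁻¹ ^ 4 = (((fzZ : ℂ))⁻¹ ^ 2) ^ 2 by ring, hi2]
  simp only [← Circle.coe_inv_eq_conj]
  fin_cases d <;> fin_cases d' <;> simp [Fin.sum_univ_three, fzQ, hi] <;> (try ring_nf) <;>
    (try simp only [hi2, hi4, h4]) <;> linear_combination h

lemma fz_orth {ι : Type} [Fintype ι] [DecidableEq ι] (m m' : ι → Fin 3) :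
    ∑ k : ι → Fin 3, ((fzMon (fzW k) m : Circle) : ℂ) *
      (starRingEnd ℂ) ((fzMon (fzW k) m' : Circle) : ℂ) =
      if m = m' then (3 : ℂ) ^ Fintype.card ι else 0 := by
  have h1 : ∀ k : ι → Fin 3, ((fzMon (fzW k) m : Circle) : ℂ) *
      (starRingEnd ℂ) ((fzMon (fzW k) m' : Circle) : ℂ) =
      ∏ t, ((((fzZ ^ (k t).val) ^ fzQ (m t) : Circle) : ℂ) *
      (starRingEnd ℂ) (((fzZ ^ (k t).val) ^ fzQ (m' t) : Circle) : ℂ)) := by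
    intro k
    rw [Finset.prod_mul_distrib, ← map_prod]
    simp only [fzMon, fzW, fz_coe_prod, map_prod]
  simp_rw [h1]
  have h2 := Finset.prod_univ_sum (fun _ : ι => (Finset.univ : Finset (Fin 3)))
    (fun t k => ((((fzZ ^ k.val) ^ fzQ (m t) : Circle) : ℂ) *
      (starRingEnd ℂ) (((fzZ ^ k.val) ^ fzQ (m' t) : Circle) : ℂ)))
  rw [Fintype.piFinset_univ] at h2
  rw [← h2]
  simp_rw [fz_digit]
  split_ifs with h
  · subst h; simp
  · obtain ⟨t, ht⟩ := Function.ne_iff.1 h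
    exact Finset.prod_eq_zero (Finset.mem_univ t) (by simp [ht])

/-- Bessel's inequality. -/
lemma fz_bessel {ι : Type} [Fintype ι] [DecidableEq ι] (h : (ι → Fin 3) → ℂ)
    (hh : ∀ k, ‖h k‖ ≤ 1) :
    ∑ m : ι → Fin 3, ‖((3 : ℂ) ^ Fintype.card ι)⁻¹ * ∑ k, ((fzMon (fzW k) m : Circle) : ℂ) * h k‖ ^ 2
      ≤ 1 := by
  set N : ℝ := 3 ^ Fintype.card ι with hN
  have hN0 : 0 < N := by positivity
  have hNc : (3 : ℂ) ^ Fintype.card ι = (N : ℂ) := by simp [hN]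
  set e : (ι → Fin 3) → (ι → Fin 3) → ℂ := fun m k => ((fzMon (fzW k) m : Circle) : ℂ) with he
  let v : (ι → Fin 3) → EuclideanSpace ℂ (ι → Fin 3) := fun m =>
    WithLp.toLp 2 (fun k => ((Real.sqrt N)⁻¹ : ℂ) * starRingEnd ℂ (e m k))
  have hs : ((Real.sqrt N : ℝ) : ℂ) * (Real.sqrt N : ℝ) = N := by
    rw [← Complex.ofReal_mul, Real.mul_self_sqrt hN0.le]
  have hs' : ((Real.sqrt N : ℝ) : ℂ)⁻¹ * ((Real.sqrt N : ℝ) : ℂ)⁻¹ = (N : ℂ)⁻¹ := by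
    rw [← mul_inv, hs]
  have hv : Orthonormal ℂ v := by
    rw [orthonormal_iff_ite]
    intro m m'
    have : inner ℂ (v m) (v m') = (N : ℂ)⁻¹ * ∑ k, e m k * starRingEnd ℂ (e m' k) := by
      rw [PiLp.inner_apply, Finset.mul_sum]
      refine Finset.sum_congr rfl fun k _ => ?_
      simp only [v, RCLike.inner_apply, map_mul, map_inv₀, Complex.conj_ofReal, Complex.conj_conj]
      rw [← hs']; ring
    rw [this, fz_orth, hNc]
    split_ifs
    · exact inv_mul_cancel₀ (by exact_mod_cast hN0.ne')
    · simp
  let x : EuclideanSpace ℂ (ι → Fin 3) := WithLp.toLp 2 (fun k => ((Real.sqrt N)⁻¹ : ℂ) * h k)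
  have hb := hv.sum_inner_products_le (x := x) (s := Finset.univ)
  have hx : ‖x‖ ^ 2 ≤ 1 := by
    rw [EuclideanSpace.norm_sq_eq]
    calc ∑ k, ‖x k‖ ^ 2 ≤ ∑ k : ι → Fin 3, N⁻¹ := by
          refine Finset.sum_le_sum fun k _ => ?_
          simp only [x, norm_mul, norm_inv, mul_pow, Complex.norm_real, Real.norm_eq_abs,
            inv_pow, sq_abs, Real.sq_sqrt hN0.le]
          have : ‖h k‖ ^ 2 ≤ 1 := pow_le_one₀ (norm_nonneg _) (hh k)
          exact mul_le_of_le_one_right (by positivity) this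
      _ = 1 := by
          simp [hN]
  refine le_trans (le_of_eq ?_) (hb.trans hx)
  refine Finset.sum_congr rfl fun m _ => ?_
  congr 2
  rw [PiLp.inner_apply, hNc, Finset.mul_sum]
  refine Finset.sum_congr rfl fun k _ => ?_
  simp only [v, x, RCLike.inner_apply, map_mul, map_inv₀, Complex.conj_ofReal, Complex.conj_conj]
  rw [← hs']; ring

lemma fz_hull {G : Type} [CommGroup G] {ι : Type} [Fintype ι] [DecidableEq ι] (τ : ι → G)
    {κ : ℝ} (hκ : 0 < κ)
    (hS : ∀ (b : ι → ℂ) (B : ℝ), (∀ χ : G →* Circle, |(∑ t, b t * (χ (τ t) : ℂ)).re| ≤ B) →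
      ∑ t, ‖b t‖ ≤ κ * B) (w : ι → Circle) {η : ℝ} (hη : 0 < η) :
    ∃ (J : Type) (_ : Fintype J) (p : J → ℝ) (s : J → Circle) (χ : J → (G →* Circle)),
      (∀ j, 0 ≤ p j) ∧ ∑ j, p j = 1 ∧ (∀ j, s j ^ 2 = 1) ∧
      ∀ t, ‖∑ j, (p j : ℂ) * (s j : ℂ) * (χ j (τ t) : ℂ) - (w t : ℂ) / κ‖ ≤ η := by
  let T : Set (ι → ℂ) := {v | ∃ (χ : G →* Circle) (s : Circle), s ^ 2 = 1 ∧
    v = fun t => (s : ℂ) * (χ (τ t) : ℂ)}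
  let x : ι → ℂ := fun t => (w t : ℂ) / κ
  have hx : x ∈ closure (convexHull ℝ T) := by
    by_contra hx
    obtain ⟨f, u, hf, hu⟩ := geometric_hahn_banach_closed_point
      (convex_convexHull ℝ T).closure isClosed_closure hx
    let b : ι → ℂ := fun t => (f (Pi.single t 1) : ℂ) - Complex.I * (f (Pi.single t Complex.I) : ℂ)
    have hfb : ∀ v, f v = (∑ t, b t * v t).re := by
      intro v
      have hv : v = ∑ t, ((v t).re • (Pi.single t 1 : ι → ℂ) +
          (v t).im • (Pi.single t Complex.I : ι → ℂ)) := by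
        funext t'
        simp only [Finset.sum_apply, Pi.add_apply, Pi.smul_apply, Pi.single_apply]
        rw [Finset.sum_eq_single t']
        · simp [Complex.re_add_im]
        · intro t _ h; simp [h.symm]
        · simp
      conv_lhs => rw [hv]
      rw [map_sum, Complex.re_sum]
      refine Finset.sum_congr rfl fun t _ => ?_
      rw [map_add, map_smul, map_smul]
      simp [b]
      ring
    have hT : ∀ v ∈ T, f v < u := fun v hv => hf v (subset_closure (subset_convexHull ℝ T hv))
    have hb := hS b u (by
      intro χ
      have h1 := hT _ ⟨χ, 1, by simp, rfl⟩
      have h2 := hT _ ⟨χ, -1, by simp, rfl⟩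
      rw [hfb] at h1 h2
      simp only [Circle.coe_neg, Circle.coe_one, one_mul, neg_mul, mul_neg, Finset.sum_neg_distrib,
        Complex.neg_re] at h1 h2
      exact abs_le.2 ⟨by linarith, by linarith⟩)
    have : f x ≤ u := by
      rw [hfb]
      calc (∑ t, b t * x t).re ≤ ‖∑ t, b t * x t‖ := Complex.re_le_norm _
        _ ≤ ∑ t, ‖b t * x t‖ := norm_sum_le _ _
        _ = (∑ t, ‖b t‖) / κ := by
          rw [Finset.sum_div]
          refine Finset.sum_congr rfl fun t _ => ?_
          simp [x, Circle.norm_coe, abs_of_pos hκ, div_eq_mul_inv]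
        _ ≤ u := by rw [div_le_iff₀ hκ]; linarith
    linarith
  obtain ⟨v, hv, hd⟩ := Metric.mem_closure_iff.1 hx η hη
  obtain ⟨J, hJ, p, y, hp0, hp1, hy, hsum⟩ := mem_convexHull_iff_exists_fintype.1 hv
  choose χ s hs hys using hy
  refine ⟨J, hJ, p, s, χ, hp0, hp1, hs, fun t => ?_⟩
  have h1 : v t = ∑ j, (p j : ℂ) * (s j : ℂ) * (χ j (τ t) : ℂ) := by
    rw [← hsum, Finset.sum_apply]
    refine Finset.sum_congr rfl fun j _ => ?_
    rw [hys j]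
    simp [mul_assoc]
  rw [← h1, ← dist_eq_norm, dist_comm]
  exact (dist_le_pi_dist x v t).trans hd.le

/-- The multi-index with exponent `-1` at `t` and `0` elsewhere. -/
def fzE {ι : Type} [DecidableEq ι] (t : ι) : ι → Fin 3 := fun s => if s = t then 0 else 1

lemma fzMon_fzE {ι : Type} [Fintype ι] [DecidableEq ι] (u : ι → Circle) (t : ι) :
    fzMon u (fzE t) = (u t)⁻¹ := by
  rw [fzMon, Finset.prod_eq_single t]
  · simp [fzE, fzQ]
  · intro s _ h; simp [fzE, fzQ, h]
  · simp

lemma fz_sample {G : Type} [CommGroup G] {ι : Type} [Fintype ι] [DecidableEq ι] (τ : ι → G)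
    {κ : ℝ} (hκ : 0 < κ)
    (hS : ∀ (b : ι → ℂ) (B : ℝ), (∀ χ : G →* Circle, |(∑ t, b t * (χ (τ t) : ℂ)).re| ≤ B) →
      ∑ t, ‖b t‖ ≤ κ * B) {η : ℝ} (hη : 0 < η) :
    ∃ (Ω : Type) (_ : Fintype Ω) (p : Ω → ℝ) (y : Ω → ι → Circle) (χ : Ω → (G →* Circle)),
      (∀ ω, 0 ≤ p ω) ∧
      (∀ γ, ∑ m : ι → Fin 3, ‖∑ ω, (p ω : ℂ) * (fzMon (y ω) m : ℂ) * (χ ω γ : ℂ)‖ ^ 2 ≤ 2) ∧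
      ∀ t, ‖∑ ω, (p ω : ℂ) * (fzMon (y ω) (fzE t) : ℂ) * (χ ω (τ t) : ℂ) - 1 / κ‖ ≤ η := by
  choose J hJ p s χ hp0 hp1 hs hap using fun k : ι → Fin 3 => fz_hull τ hκ hS (fzW k) hη
  set N : ℂ := (3 : ℂ) ^ Fintype.card ι with hN
  have hNr : (((3 : ℝ) ^ Fintype.card ι : ℝ) : ℂ) = N := by simp [hN]
  have hN0 : N ≠ 0 := by simp [hN]
  let p' : (Σ k, J k) → ℝ := fun ω => ((3 : ℝ) ^ Fintype.card ι)⁻¹ * p ω.1 ω.2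
  let y : (Σ k, J k) → ι → Circle := fun ω t => fzW ω.1 t * s ω.1 ω.2
  let χ' : (Σ k, J k) → (G →* Circle) := fun ω => χ ω.1 ω.2
  have hA : ∀ γ m, ∑ ω, (p' ω : ℂ) * (fzMon (y ω) m : ℂ) * (χ' ω γ : ℂ) =
      N⁻¹ * ∑ k, (fzMon (fzW k) m : ℂ) *
        ∑ j, (p k j : ℂ) * (fzMon (fun _ : ι => s k j) m : ℂ) * (χ k j γ : ℂ) := by
    intro γ m
    rw [Fintype.sum_sigma, Finset.mul_sum]
    refine Finset.sum_congr rfl fun k _ => ?_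
    rw [Finset.mul_sum, Finset.mul_sum]
    refine Finset.sum_congr rfl fun j _ => ?_
    simp only [p', y, χ', fzMon_mul, Circle.coe_mul, Complex.ofReal_mul, Complex.ofReal_inv, hNr]
    ring
  refine ⟨Σ k, J k, inferInstance, p', y, χ', fun ω => mul_nonneg (by positivity) (hp0 _ _), ?_, ?_⟩
  · intro γ
    simp_rw [hA]
    let h0 : (ι → Fin 3) → ℂ := fun k => ∑ j, (p k j : ℂ) * (χ k j γ : ℂ)
    let h1 : (ι → Fin 3) → ℂ := fun k => ∑ j, (p k j : ℂ) * (s k j : ℂ) * (χ k j γ : ℂ)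
    have b0 := fz_bessel h0 (fun k => by
      refine (norm_sum_le _ _).trans (le_of_eq ?_)
      rw [← hp1 k]
      exact Finset.sum_congr rfl fun j _ => by simp [Circle.norm_coe, abs_of_nonneg (hp0 k j)])
    have b1 := fz_bessel h1 (fun k => by
      refine (norm_sum_le _ _).trans (le_of_eq ?_)
      rw [← hp1 k]
      exact Finset.sum_congr rfl fun j _ => by simp [Circle.norm_coe, abs_of_nonneg (hp0 k j)])
    have hle := add_le_add b0 b1
    rw [← Finset.sum_add_distrib] at hle
    norm_num at hle
    refine le_trans (Finset.sum_le_sum fun m _ => ?_) (hle.trans (by norm_num))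
    have hsm : ∀ k j, fzMon (fun _ : ι => s k j) m = s k j ^ (∑ t, fzQ (m t)) := by
      intro k j
      rw [fzMon]
      exact (Finset.univ : Finset ι).induction_on (by simp) (fun a S ha ih => by
        rw [Finset.prod_insert ha, Finset.sum_insert ha, zpow_add, ih])
    rcases Int.even_or_odd' (∑ t, fzQ (m t)) with ⟨n, hn | hn⟩
    · have e : ∀ k j, fzMon (fun _ : ι => s k j) m = 1 := fun k j => by
        rw [hsm, hn, zpow_mul, zpow_ofNat, hs, one_zpow]
      simp only [e, Circle.coe_one, mul_one, norm_mul, norm_inv]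
      have := sq_nonneg (‖N⁻¹ * ∑ k, (fzMon (fzW k) m : ℂ) * h1 k‖)
      simp only [h0, h1, N, norm_mul, norm_inv, norm_pow] at this ⊢
      simpa using this
    · have e : ∀ k j, fzMon (fun _ : ι => s k j) m = s k j := fun k j => by
        rw [hsm, hn, zpow_add, zpow_mul, zpow_ofNat, hs, one_zpow, one_mul, zpow_one]
      simp only [e, norm_mul, norm_inv]
      have := sq_nonneg (‖N⁻¹ * ∑ k, (fzMon (fzW k) m : ℂ) * h0 k‖)
      simp only [h0, h1, N, norm_mul, norm_inv, norm_pow] at this ⊢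
      simpa using this
  · intro t
    rw [hA]
    have hs' : ∀ k j, (s k j)⁻¹ = s k j := fun k j => by
      rw [inv_eq_iff_mul_eq_one, ← sq, hs]
    simp only [fzMon_fzE, hs']
    have e : N⁻¹ * ∑ k, (((fzW k t)⁻¹ : Circle) : ℂ) *
        ∑ j, (p k j : ℂ) * (s k j : ℂ) * (χ k j (τ t) : ℂ) - 1 / κ =
        N⁻¹ * ∑ k, (((fzW k t)⁻¹ : Circle) : ℂ) *
        (∑ j, (p k j : ℂ) * (s k j : ℂ) * (χ k j (τ t) : ℂ) - (fzW k t : ℂ) / κ) := by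
      simp only [mul_sub, Finset.sum_sub_distrib]
      congr 1
      have : ∀ k : ι → Fin 3, (((fzW k t)⁻¹ : Circle) : ℂ) * ((fzW k t : ℂ) / κ) = 1 / κ := by
        intro k
        rw [← mul_div_assoc, ← Circle.coe_mul]; simp
      simp only [this, Finset.sum_const, Finset.card_univ, nsmul_eq_mul]
      rw [← mul_assoc]
      have : ((Fintype.card (ι → Fin 3) : ℕ) : ℂ) = N := by simp [hN]
      rw [this, inv_mul_cancel₀ hN0, one_mul]
    rw [e, norm_mul, norm_inv]
    have hNn : ‖N‖ = Fintype.card (ι → Fin 3) := by simp [hN]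
    rw [inv_mul_le_iff₀ (norm_pos_iff.2 hN0)]
    refine (norm_sum_le _ _).trans ?_
    refine (Finset.sum_le_sum (g := fun _ => η) fun k _ => ?_).trans (le_of_eq ?_)
    · rw [norm_mul, Circle.norm_coe, one_mul]; exact hap k t
    · rw [hNn]; simp

/-- The coefficients of the Riesz product factor. -/
noncomputable def fzC (ε : ℝ) (d : Fin 3) : ℝ := if d = 1 then 1 else ε / 2

lemma fz_factor (ε : ℝ) (u : Circle) :
    ((1 + ε * (u : ℂ).re : ℝ) : ℂ) = ∑ d : Fin 3, (fzC ε d : ℂ) * ((u ^ fzQ d : Circle) : ℂ) := by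
  simp only [Fin.sum_univ_three, fzC, fzQ]
  have h : ((u⁻¹ : Circle) : ℂ) = starRingEnd ℂ (u : ℂ) := Circle.coe_inv_eq_conj u
  have h2 := Complex.add_conj (u : ℂ)
  have e0 : (((0 : Fin 3).val : ℤ) - 1) = -1 := rfl
  have e1 : (((1 : Fin 3).val : ℤ) - 1) = 0 := rfl
  have e2 : (((2 : Fin 3).val : ℤ) - 1) = 1 := rfl
  rw [e0, e1, e2, zpow_neg_one, zpow_zero, zpow_one, h]
  have : (((u : ℂ).re : ℝ) : ℂ) = ((u : ℂ) + starRingEnd ℂ (u : ℂ)) / 2 := by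
    rw [h2]; push_cast; ring
  simp [this]
  ring

/-- The group element attached to a multi-index. -/
def fzPi {G : Type} [CommGroup G] {ι : Type} [Fintype ι] (τ : ι → G) (m : ι → Fin 3) : G :=
  ∏ t, τ t ^ fzQ (m t)

lemma fz_riesz_expand {ι : Type} [Fintype ι] [DecidableEq ι] (ε : ℝ) (u : ι → Circle) :
    ((∏ t, (1 + ε * (u t : ℂ).re) : ℝ) : ℂ) =
      ∑ m : ι → Fin 3, ((∏ t, fzC ε (m t) : ℝ) : ℂ) * (fzMon u m : ℂ) := by
  rw [Complex.ofReal_prod]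
  simp_rw [fz_factor]
  rw [Finset.prod_univ_sum, Fintype.piFinset_univ]
  refine Finset.sum_congr rfl fun m _ => ?_
  rw [Finset.prod_mul_distrib, fzMon, fz_coe_prod, Complex.ofReal_prod]

open Classical in
lemma fz_riesz_integral {G : Type} [CommGroup G] {ι : Type} [Fintype ι] [DecidableEq ι]
    (τ : ι → G) {X : Type} [TopologicalSpace X] [CompactSpace X] [MeasurableSpace X]
    [BorelSpace X] (μ : Measure X) [IsProbabilityMeasure μ] (ev : X → (G →* Circle))
    (hc : ∀ g, Continuous fun x => ev x g)
    (h0 : ∀ g, g ≠ 1 → ∫ x, ((ev x g : Circle) : ℂ) ∂μ = 0)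
    (ε : ℝ) (u : ι → Circle) (γ : G) :
    ∫ x, ((∏ t, (1 + ε * ((u t * ev x (τ t) : Circle) : ℂ).re) : ℝ) : ℂ) * (ev x γ : ℂ) ∂μ =
      ∑ m : ι → Fin 3, ((∏ t, fzC ε (m t) : ℝ) : ℂ) * (fzMon u m : ℂ) *
        (if fzPi τ m * γ = 1 then 1 else 0) := by
  have h1 : ∀ x, ((∏ t, (1 + ε * ((u t * ev x (τ t) : Circle) : ℂ).re) : ℝ) : ℂ) * (ev x γ : ℂ) =
      ∑ m : ι → Fin 3, ((∏ t, fzC ε (m t) : ℝ) : ℂ) * (fzMon u m : ℂ) *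
        (ev x (fzPi τ m * γ) : ℂ) := by
    intro x
    rw [fz_riesz_expand ε (fun t => u t * ev x (τ t)), Finset.sum_mul]
    refine Finset.sum_congr rfl fun m _ => ?_
    have : fzMon (fun t => ev x (τ t)) m = ev x (fzPi τ m) := by
      simp [fzMon, fzPi, map_prod]
    rw [fzMon_mul, this, map_mul, Circle.coe_mul, Circle.coe_mul]
    ring
  simp_rw [h1]
  rw [integral_finsetSum]
  · refine Finset.sum_congr rfl fun m _ => ?_
    rw [integral_const_mul]
    congr 1
    split_ifs with h
    · simp [h]
    · exact h0 _ h
  · intro m _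
    have := hc (fzPi τ m * γ)
    exact Continuous.integrable_of_hasCompactSupport (by fun_prop) (HasCompactSupport.of_compactSpace _)

lemma fz_comb {G : Type} [CommGroup G] {ι : Type} [Fintype ι] [DecidableEq ι]
    (τ : ι → G) (hinj : Function.Injective τ) (hτ : ∀ s t, τ s * τ t ≠ 1) (t : ι)
    (m : ι → Fin 3) (hm : fzPi τ m * τ t = 1) (hne : m ≠ fzE t) :
    ∃ s s', s ≠ s' ∧ m s ≠ 1 ∧ m s' ≠ 1 := by
  by_contra hcon
  push Not at hcon
  by_cases hall : ∀ s, m s = 1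
  · have : fzPi τ m = 1 := by
      simp [fzPi, hall, fzQ]
    rw [this, one_mul] at hm
    exact hτ t t (by rw [hm, one_mul])
  · push Not at hall
    obtain ⟨s, hs⟩ := hall
    have ho : ∀ s', s' ≠ s → m s' = 1 := fun s' h => hcon s s' h.symm hs
    have hp : fzPi τ m = τ s ^ fzQ (m s) := by
      rw [fzPi, Finset.prod_eq_single s]
      · intro b _ hb; simp [ho b hb, fzQ]
      · simp
    rw [hp] at hm
    have : m s = 0 ∨ m s = 2 := by
      generalize m s = d at hs
      fin_cases d <;> simp_all
    rcases this with h | h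
    · rw [h] at hm
      have e : fzQ 0 = -1 := rfl
      rw [e, zpow_neg_one, inv_mul_eq_one] at hm
      have := hinj hm
      subst this
      apply hne
      funext b
      by_cases hb : b = s
      · simp [fzE, hb, h]
      · simp [fzE, hb, ho b hb]
    · rw [h] at hm
      have e : fzQ 2 = 1 := rfl
      rw [e, zpow_one] at hm
      exact hτ _ _ hm

lemma fzC_nonneg {ε : ℝ} (h : 0 ≤ ε) (d : Fin 3) : 0 ≤ fzC ε d := by
  unfold fzC; split_ifs <;> linarith

lemma fzC_le {ε : ℝ} (h1 : ε ≤ 1) (d : Fin 3) : fzC ε d ≤ 1 := by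
  unfold fzC; split_ifs <;> linarith

lemma fzC_prod_le {ι : Type} [Fintype ι] [DecidableEq ι] {ε : ℝ} (h : 0 ≤ ε) (h1 : ε ≤ 1)
    (m : ι → Fin 3) {s s' : ι} (hss : s ≠ s') (hs : m s ≠ 1) (hs' : m s' ≠ 1) :
    ∏ t, fzC ε (m t) ≤ (ε / 2) ^ 2 := by
  have hle : ∏ t, fzC ε (m t) ≤ ∏ t ∈ ({s, s'} : Finset ι), fzC ε (m t) := by
    rw [← Finset.prod_sdiff (Finset.subset_univ ({s, s'} : Finset ι))]
    refine mul_le_of_le_one_left (Finset.prod_nonneg fun _ _ => fzC_nonneg h _) ?_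
    exact Finset.prod_le_one (fun _ _ => fzC_nonneg h _) (fun _ _ => fzC_le h1 _)
  refine hle.trans (le_of_eq ?_)
  rw [Finset.prod_pair hss]
  simp [sq, hs, hs', fzC, if_neg]

/-- The main construction: a positive definite function close to a multiple of `conj z`. -/
lemma fz_key {G : Type} [CommGroup G] {ι : Type} [Fintype ι] [DecidableEq ι]
    (τ : ι → G) (hinj : Function.Injective τ) (hτ : ∀ s t, τ s * τ t ≠ 1)
    {κ : ℝ} (hκ : 1 ≤ κ)
    (hS : ∀ (b : ι → ℂ) (B : ℝ), (∀ χ : G →* Circle, |(∑ t, b t * (χ (τ t) : ℂ)).re| ≤ B) →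
      ∑ t, ‖b t‖ ≤ κ * B) {ε : ℝ} (hε : 0 < ε) (hε1 : ε ≤ 1) (z : ι → Circle) :
    ∃ S : G → ℂ, ‖S 1‖ ≤ 2 ∧
      (∀ t, ‖S (τ t) - ε / 2 * (1 / κ) ^ 2 * ((z t)⁻¹ : Circle)‖ ≤ ε ^ 2) ∧
      ∀ (c : ℝ) (a : ι → ℂ), (∀ χ : G →* Circle, 0 ≤ (c + ∑ t, a t * (χ (τ t) : ℂ)).re) →
        0 ≤ (c * S 1 + ∑ t, a t * S (τ t)).re := by
  classical
  obtain ⟨X, _, _, _, _, μ, _, ev, hc, h0⟩ := fz_exists_mean G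
  obtain ⟨Ω, _, p, y, χ, hp, hB, hA⟩ := fz_sample τ (by linarith) hS (η := ε / 3) (by linarith)
  let ρ : Ω → Ω → X → ℝ := fun ω ω' x =>
    ∏ t, (1 + ε * ((z t * (y ω t * y ω' t) * ev x (τ t) : Circle) : ℂ).re)
  have hρ : ∀ ω ω' x, 0 ≤ ρ ω ω' x := by
    intro ω ω' x
    refine Finset.prod_nonneg fun t _ => ?_
    have h1 := Complex.abs_re_le_norm ((z t * (y ω t * y ω' t) * ev x (τ t) : Circle) : ℂ)
    rw [Circle.norm_coe] at h1
    have h2 := (abs_le.1 h1).1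
    nlinarith
  have hρc : ∀ ω ω', Continuous (ρ ω ω') := by
    intro ω ω'
    refine continuous_finsetProd _ fun t _ => ?_
    have := hc (τ t)
    fun_prop
  let S : G → ℂ := fun γ => ∑ ω, ∑ ω', ((p ω * p ω' : ℝ) : ℂ) * ((χ ω γ : ℂ) * (χ ω' γ : ℂ)) *
    ∫ x, (ρ ω ω' x : ℂ) * (ev x γ : ℂ) ∂μ
  let A : G → (ι → Fin 3) → ℂ := fun γ m => ∑ ω, (p ω : ℂ) * (fzMon (y ω) m : ℂ) * (χ ω γ : ℂ)
  have hSA : ∀ γ, S γ = ∑ m : ι → Fin 3, ((∏ t, fzC ε (m t) : ℝ) : ℂ) * (fzMon z m : ℂ) *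
        (if fzPi τ m * γ = 1 then 1 else 0) * (A γ m) ^ 2 := by
    intro γ
    simp only [S, ρ]
    have := fun ω ω' => fz_riesz_integral τ μ ev hc h0 ε (fun t => z t * (y ω t * y ω' t)) γ
    simp_rw [this, Finset.mul_sum]
    simp_rw [Finset.sum_comm (s := (Finset.univ : Finset Ω)) (t := (Finset.univ : Finset (ι → Fin 3)))]
    refine Finset.sum_congr rfl fun m _ => ?_
    simp only [A]
    rw [sq, Finset.sum_mul_sum, Finset.mul_sum]
    refine Finset.sum_congr rfl fun ω _ => ?_
    rw [Finset.mul_sum]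
    refine Finset.sum_congr rfl fun ω' _ => ?_
    rw [fzMon_mul, fzMon_mul]
    push_cast
    ring
  have hprod : ∀ m : ι → Fin 3, ‖((∏ t, fzC ε (m t) : ℝ) : ℂ)‖ = ∏ t, fzC ε (m t) := by
    intro m
    rw [Complex.norm_real, Real.norm_eq_abs,
      abs_of_nonneg (Finset.prod_nonneg fun _ _ => fzC_nonneg hε.le _)]
  refine ⟨S, ?_, ?_, ?_⟩
  · rw [hSA]
    refine (norm_sum_le _ _).trans (le_trans (Finset.sum_le_sum fun m _ => ?_) (hB 1))
    rw [norm_mul, norm_mul, norm_mul, hprod, Circle.norm_coe, norm_pow, mul_one]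
    refine mul_le_of_le_one_left (by positivity) ?_
    have h1 : ∏ t, fzC ε (m t) ≤ 1 :=
      Finset.prod_le_one (fun _ _ => fzC_nonneg hε.le _) (fun _ _ => fzC_le hε1 _)
    split_ifs <;> simp [h1]
  · intro t
    have hAt := hA t
    change ‖A (τ t) (fzE t) - 1 / κ‖ ≤ ε / 3 at hAt
    have hm0 : fzPi τ (fzE t) * τ t = 1 := by
      have : fzPi τ (fzE t) = (τ t)⁻¹ := by
        rw [fzPi, Finset.prod_eq_single t]
        · simp [fzE, fzQ]
        · intro s _ h; simp [fzE, fzQ, h]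
        · simp
      rw [this, inv_mul_cancel]
    have hc0 : ∏ s, fzC ε (fzE t s) = ε / 2 := by
      rw [Finset.prod_eq_single t]
      · simp [fzE, fzC]
      · intro s _ h; simp [fzE, fzC, h]
      · simp
    rw [hSA, ← Finset.add_sum_erase _ _ (Finset.mem_univ (fzE t)), hc0, fzMon_fzE, if_pos hm0]
    have herr : ‖∑ m ∈ Finset.univ.erase (fzE t), ((∏ t, fzC ε (m t) : ℝ) : ℂ) * (fzMon z m : ℂ) *
        (if fzPi τ m * τ t = 1 then 1 else 0) * (A (τ t) m) ^ 2‖ ≤ ε ^ 2 / 2 := by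
      refine (norm_sum_le _ _).trans ?_
      have : ∑ m ∈ Finset.univ.erase (fzE t), (ε / 2) ^ 2 * ‖A (τ t) m‖ ^ 2 ≤ ε ^ 2 / 2 := by
        rw [← Finset.mul_sum]
        have h2 : ∑ m ∈ Finset.univ.erase (fzE t), ‖A (τ t) m‖ ^ 2 ≤ 2 :=
          le_trans (Finset.sum_le_sum_of_subset_of_nonneg (Finset.subset_univ _)
            (fun _ _ _ => by positivity)) (hB (τ t))
        nlinarith [sq_nonneg ε]
      refine le_trans (Finset.sum_le_sum fun m hm => ?_) this
      rw [norm_mul, norm_mul, norm_mul, hprod, Circle.norm_coe, norm_pow, mul_one]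
      refine mul_le_mul_of_nonneg_right ?_ (by positivity)
      split_ifs with hpm
      · obtain ⟨s, s', hss, hs, hs'⟩ := fz_comb τ hinj hτ t m hpm (Finset.ne_of_mem_erase hm)
        simpa using fzC_prod_le hε.le hε1 m hss hs hs'
      · simp; positivity
    set R := ∑ m ∈ Finset.univ.erase (fzE t), ((∏ t, fzC ε (m t) : ℝ) : ℂ) * (fzMon z m : ℂ) *
        (if fzPi τ m * τ t = 1 then 1 else 0) * (A (τ t) m) ^ 2
    set B := A (τ t) (fzE t)
    have e : ((ε / 2 : ℝ) : ℂ) * (((z t)⁻¹ : Circle) : ℂ) * 1 * B ^ 2 + R -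
        ε / 2 * (1 / κ) ^ 2 * (((z t)⁻¹ : Circle) : ℂ) =
        R + ((ε / 2 : ℝ) : ℂ) * (((z t)⁻¹ : Circle) : ℂ) * ((B - 1 / κ) * (B - 1 / κ + 2 * (1 / κ))) := by
      push_cast; ring
    rw [e]
    refine (norm_add_le _ _).trans ?_
    have h3 : ‖((ε / 2 : ℝ) : ℂ) * (((z t)⁻¹ : Circle) : ℂ) *
        ((B - 1 / κ) * (B - 1 / κ + 2 * (1 / κ)))‖ ≤ ε ^ 2 / 2 := by
      rw [norm_mul, norm_mul, norm_mul, Circle.norm_coe, Complex.norm_real, Real.norm_eq_abs,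
        abs_of_pos (by positivity), mul_one]
      have h4 : ‖(1 / κ : ℂ)‖ ≤ 1 := by
        rw [norm_div, norm_one, Complex.norm_real, Real.norm_eq_abs, abs_of_pos (by linarith)]
        rw [div_le_one (by linarith)]; exact hκ
      have h5 : ‖B - 1 / κ + 2 * (1 / κ)‖ ≤ 3 := by
        refine (norm_add_le _ _).trans ?_
        rw [norm_mul]
        norm_num at h4 ⊢
        norm_num at hAt
        linarith
      have h6 : ‖B - 1 / κ‖ * ‖B - 1 / κ + 2 * (1 / κ)‖ ≤ ε / 3 * 3 :=
        mul_le_mul hAt h5 (norm_nonneg _) (by linarith)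
      nlinarith
    linarith
  · intro c a hpos
    have hint : ∀ ω ω' γ, Integrable (fun x => (ρ ω ω' x : ℂ) * (ev x γ : ℂ)) μ := by
      intro ω ω' γ
      have := hρc ω ω'
      have := hc γ
      exact Continuous.integrable_of_hasCompactSupport (by fun_prop)
        (HasCompactSupport.of_compactSpace _)
    have e : c * S 1 + ∑ t, a t * S (τ t) = ∑ ω, ∑ ω', ((p ω * p ω' : ℝ) : ℂ) *
        ∫ x, (ρ ω ω' x : ℂ) * (c + ∑ t, a t * ((ev x * χ ω * χ ω') (τ t) : ℂ)) ∂μ := by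
      have e1 : ∀ ω ω', ∫ x, (ρ ω ω' x : ℂ) * (c + ∑ t, a t * ((ev x * χ ω * χ ω') (τ t) : ℂ)) ∂μ =
          c * ∫ x, (ρ ω ω' x : ℂ) * (ev x 1 : ℂ) ∂μ +
          ∑ t, a t * ((χ ω (τ t) : ℂ) * (χ ω' (τ t) : ℂ)) *
            ∫ x, (ρ ω ω' x : ℂ) * (ev x (τ t) : ℂ) ∂μ := by
        intro ω ω'
        simp_rw [← integral_const_mul]
        rw [← integral_finsetSum, ← integral_add]
        · congr 1
          funext x
          rw [mul_add, Finset.mul_sum]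
          congr 1
          · simp; ring
          · refine Finset.sum_congr rfl fun t _ => ?_
            simp only [MonoidHom.mul_apply, Circle.coe_mul]; ring
        · exact (hint _ _ _).const_mul _
        · exact integrable_finsetSum _ fun t _ => (hint _ _ _).const_mul _
        · exact fun t _ => (hint _ _ _).const_mul _
      simp_rw [e1]
      simp only [S, Finset.mul_sum, mul_add, Finset.sum_add_distrib]
      congr 1
      · refine Finset.sum_congr rfl fun ω _ => Finset.sum_congr rfl fun ω' _ => ?_
        simp; ring
      · rw [Finset.sum_comm]
        refine Finset.sum_congr rfl fun ω _ => ?_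
        rw [Finset.sum_comm]
        refine Finset.sum_congr rfl fun ω' _ => Finset.sum_congr rfl fun t _ => ?_
        ring
    rw [e, Complex.re_sum]
    refine Finset.sum_nonneg fun ω _ => ?_
    rw [Complex.re_sum]
    refine Finset.sum_nonneg fun ω' _ => ?_
    rw [Complex.re_ofReal_mul]
    refine mul_nonneg (mul_nonneg (hp _) (hp _)) ?_
    have hi : Integrable (fun x => (ρ ω ω' x : ℂ) *
        (c + ∑ t, a t * ((ev x * χ ω * χ ω') (τ t) : ℂ))) μ := by
      have := hρc ω ω'
      have := fun t => hc (τ t)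
      refine Continuous.integrable_of_hasCompactSupport ?_ (HasCompactSupport.of_compactSpace _)
      simp only [MonoidHom.mul_apply]
      fun_prop
    have := integral_re hi
    simp only [RCLike.re_eq_complex_re] at this
    rw [← this]
    refine integral_nonneg fun x => ?_
    simp only [Pi.zero_apply]
    rw [Complex.re_ofReal_mul]
    exact mul_nonneg (hρ _ _ _) (hpos _)

lemma fz_c_nonneg {G : Type} [CommGroup G] {ι : Type} [Fintype ι]
    (τ : ι → G) (hτ : ∀ t, τ t ≠ 1) (c : ℝ) (a : ι → ℂ)
    (hpos : ∀ χ : G →* Circle, 0 ≤ (c + ∑ t, a t * (χ (τ t) : ℂ)).re) : 0 ≤ c := by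
  obtain ⟨X, _, _, _, _, μ, _, ev, hc, h0⟩ := fz_exists_mean G
  have hint : ∀ t, Integrable (fun x => a t * (ev x (τ t) : ℂ)) μ := by
    intro t
    have := hc (τ t)
    exact Continuous.integrable_of_hasCompactSupport (by fun_prop)
      (HasCompactSupport.of_compactSpace _)
  have hi : Integrable (fun x => (c : ℂ) + ∑ t, a t * (ev x (τ t) : ℂ)) μ :=
    (integrable_const _).add (integrable_finsetSum _ fun t _ => hint t)
  have h1 : ∫ x, ((c : ℂ) + ∑ t, a t * (ev x (τ t) : ℂ)) ∂μ = c := by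
    rw [integral_add (integrable_const _) (integrable_finsetSum _ fun t _ => hint t),
      integral_finsetSum _ fun t _ => hint t]
    simp [integral_const_mul, h0 _ (hτ _)]
  have h2 := integral_re hi
  simp only [RCLike.re_eq_complex_re] at h2
  rw [h1, Complex.ofReal_re] at h2
  rw [← h2]
  exact integral_nonneg fun x => hpos _

lemma fz_split {G : Type} [CommGroup G] (E : Finset G) (hE : ∀ s ∈ E, ∀ t ∈ E, s * t ≠ 1)
    {M : Type} [AddCommMonoid M] (F : G → M) (hF : ∀ g, F g ≠ 0 → g ∈ E ∨ g⁻¹ ∈ E) :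
    ∑ᶠ g, F g = ∑ t : E, (F t + F (t : G)⁻¹) := by
  classical
  have hd : Disjoint E (E.image (fun g => g⁻¹)) := by
    rw [Finset.disjoint_left]
    intro g hg hg'
    obtain ⟨s, hs, rfl⟩ := Finset.mem_image.1 hg'
    exact hE s hs _ hg (mul_inv_cancel s)
  rw [finsum_eq_sum_of_support_subset (s := E ∪ E.image (fun g => g⁻¹)), Finset.sum_union hd,
    Finset.sum_image (by intro x _ y _ h; exact inv_injective h), Finset.sum_add_distrib,
    Finset.sum_coe_sort E (fun t => F t), Finset.sum_coe_sort E (fun t => F t⁻¹)]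
  intro g hg
  rcases hF g hg with h | h
  · simp [h]
  · simp only [Finset.coe_union, Finset.coe_image, Set.mem_union, Finset.mem_coe, Set.mem_image]
    exact Or.inr ⟨_, h, inv_inv g⟩

lemma fz_phase (a : ℂ) : ∃ z : Circle, a * (z : ℂ) = -(‖a‖ : ℂ) := by
  by_cases ha : a = 0
  · exact ⟨1, by simp [ha]⟩
  · have hn : (‖a‖ : ℂ) ≠ 0 := by simpa using ha
    refine ⟨⟨-(starRingEnd ℂ a) / ‖a‖, ?_⟩, ?_⟩
    · apply mem_sphere_zero_iff_norm.2
      simp [ha]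
    · have := Complex.mul_conj' a
      simp only
      field_simp
      rw [this]

theorem commutative_sidon_iff_fatouZygmund_positivity {G : Type} [CommGroup G]
    (Λ Λ₁ : Set G) (hΛ1 : (1 : G) ∉ Λ) (hsym : Λ⁻¹ = Λ) (horder : ∀ t ∈ Λ, t * t ≠ 1)
    (hunion : Λ = Λ₁ ∪ Λ₁⁻¹) (hdisj : Λ₁ ∩ Λ₁⁻¹ = ∅) :
    (∃ κ : ℝ, ∀ a : G → ℂ, (Function.support a).Finite → Function.support a ⊆ Λ →
        ∑ᶠ t, ‖a t‖ ≤ κ * ⨆ χ : G →* Circle, ‖∑ᶠ t, a t * ((χ t : Circle) : ℂ)‖) ↔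
    (∃ δ : ℝ, 0 < δ ∧ ∀ (c : ℝ) (a : G → ℂ), (Function.support a).Finite →
        Function.support a ⊆ Λ → (∀ t : G, a t⁻¹ = starRingEnd ℂ (a t)) →
        (∀ χ : G →* Circle, 0 ≤ ((c : ℂ) + ∑ᶠ t, a t * ((χ t : Circle) : ℂ)).re) →
        ∀ z : G → Circle,
          0 ≤ ((c : ℂ) + (δ : ℂ) * ∑ᶠ t ∈ Λ₁, (a t * ((z t : Circle) : ℂ) +
            a t⁻¹ * starRingEnd ℂ ((z t : Circle) : ℂ))).re) := by
  classical
  have hdis : ∀ s ∈ Λ₁, ∀ t ∈ Λ₁, s * t ≠ 1 := by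
    intro s hs t ht h
    have : s ∈ Λ₁ ∩ Λ₁⁻¹ := ⟨hs, by rw [Set.mem_inv, inv_eq_of_mul_eq_one_right h]; exact ht⟩
    rw [hdisj] at this
    exact this
  have hsub : Λ₁ ⊆ Λ := by rw [hunion]; exact Set.subset_union_left
  have hmem : ∀ g ∈ Λ, g ∈ Λ₁ ∨ g⁻¹ ∈ Λ₁ := by
    intro g hg; rw [hunion] at hg; exact hg
  have hinvΛ : ∀ g ∈ Λ, g⁻¹ ∈ Λ := by
    intro g hg; rw [← hsym] at hg; exact hg
  -- a finite half support
  have hhalf : ∀ a : G → ℂ, (Function.support a).Finite → Function.support a ⊆ Λ →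
      ∃ E : Finset G, (E : Set G) ⊆ Λ₁ ∧ ∀ g, a g ≠ 0 → g ∈ E ∨ g⁻¹ ∈ E := by
    intro a hf hs
    refine ⟨(hf.toFinset ∪ hf.toFinset.image (fun g => g⁻¹)).filter (· ∈ Λ₁), ?_, ?_⟩
    · intro g hg; simp at hg; exact hg.2
    · intro g hg
      rcases hmem g (hs hg) with h | h
      · left; simp [h, hg]
      · right; simp [h, hg]
  have hconj : ∀ (χ : G →* Circle) (g : G), (χ g⁻¹ : ℂ) = starRingEnd ℂ (χ g : ℂ) := by
    intro χ g; rw [map_inv, Circle.coe_inv_eq_conj]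
  have hherm : ∀ (E : Finset G) (h : G → ℂ), (∀ t : G, h t⁻¹ = starRingEnd ℂ (h t)) →
      ∑ t : E, (‖h t‖ + ‖h (t : G)⁻¹‖) = 2 * ∑ t : E, ‖h t‖ := by
    intro E h hh
    rw [Finset.mul_sum]
    refine Finset.sum_congr rfl fun t _ => ?_
    rw [hh, RCLike.norm_conj]; ring
  have hherm2 : ∀ (E : Finset G) (h : G → ℂ), (∀ t : G, h t⁻¹ = starRingEnd ℂ (h t)) →
      ∀ χ : G →* Circle, ∑ t : E, (h t * (χ t : ℂ) + h (t : G)⁻¹ * (χ (t : G)⁻¹ : ℂ)) =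
        ((2 * (∑ t : E, h t * (χ t : ℂ)).re : ℝ) : ℂ) := by
    intro E h hh χ
    rw [Complex.re_sum, Finset.mul_sum, Complex.ofReal_sum]
    refine Finset.sum_congr rfl fun t _ => ?_
    rw [hh, hconj, ← map_mul, Complex.add_conj]
  constructor
  · rintro ⟨κ₀, hκ₀⟩
    set κ : ℝ := max κ₀ 1 with hκdef
    have hκ1 : 1 ≤ κ := le_max_right _ _
    set k : ℝ := (1 / κ) ^ 2 with hk
    have hk0 : 0 < k := by positivity
    have hk1 : k ≤ 1 := by
      have : 1 / κ ≤ 1 := by rw [div_le_one (by linarith)]; exact hκ1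
      exact pow_le_one₀ (by positivity) this
    refine ⟨k ^ 2 / 32, by positivity, ?_⟩
    intro c a hf hs hh hpos z
    obtain ⟨E, hE1, hE⟩ := hhalf a hf hs
    have hEd : ∀ s ∈ E, ∀ t ∈ E, s * t ≠ 1 := fun s hs t ht => hdis s (hE1 hs) t (hE1 ht)
    let τ : E → G := fun t => t
    have hS : ∀ (b : E → ℂ) (B : ℝ),
        (∀ χ : G →* Circle, |(∑ t, b t * (χ (τ t) : ℂ)).re| ≤ B) → ∑ t, ‖b t‖ ≤ κ * B := by
      intro b B hB
      have hB0 : 0 ≤ B := (abs_nonneg _).trans (hB 1)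
      let a' : G → ℂ := fun g => if h : g ∈ E then b ⟨g, h⟩ else
        if h : g⁻¹ ∈ E then starRingEnd ℂ (b ⟨g⁻¹, h⟩) else 0
      have ha1 : ∀ t : E, a' t = b t := fun t => by simp [a']
      have hnot : ∀ t ∈ E, t⁻¹ ∉ E := fun t ht ht' => hEd t ht _ ht' (mul_inv_cancel t)
      have ha' : ∀ g, a' g ≠ 0 → g ∈ E ∨ g⁻¹ ∈ E := by
        intro g hg
        by_contra hcon
        push Not at hcon
        exact hg (by simp [a', hcon.1, hcon.2])
      have hh' : ∀ t, a' t⁻¹ = starRingEnd ℂ (a' t) := by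
        intro t
        by_cases h1 : t ∈ E
        · simp [a', h1, hnot t h1]
        · by_cases h2 : t⁻¹ ∈ E
          · simp [a', h1, h2]
          · simp [a', h1, h2]
      have hfin : (Function.support a').Finite := by
        refine (E ∪ E.image (fun g => g⁻¹)).finite_toSet.subset ?_
        intro g hg
        rcases ha' g hg with h | h
        · simp [h]
        · simp only [Finset.coe_union, Finset.coe_image, Set.mem_union, Finset.mem_coe,
            Set.mem_image]
          exact Or.inr ⟨_, h, inv_inv g⟩
      have hsupp : Function.support a' ⊆ Λ := by
        intro g hg
        rcases ha' g hg with h | h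
        · exact hsub (hE1 h)
        · rw [← inv_inv g]; exact hinvΛ _ (hsub (hE1 h))
      have h1 := hκ₀ a' hfin hsupp
      rw [fz_split E hEd (fun t => ‖a' t‖) (fun g hg => ha' g (by simpa using hg)), hherm E a' hh'] at h1
      have h2 : ⨆ χ : G →* Circle, ‖∑ᶠ t, a' t * ((χ t : Circle) : ℂ)‖ ≤ 2 * B := by
        refine ciSup_le fun χ => ?_
        rw [fz_split E hEd (fun t => a' t * (χ t : ℂ)) (fun g hg => ha' g (left_ne_zero_of_mul hg)),
          hherm2 E a' hh', Complex.norm_real, Real.norm_eq_abs, abs_mul, abs_two]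
        simp only [ha1]
        have := hB χ
        simp only [τ] at this
        linarith
      have h3 : 0 ≤ ⨆ χ : G →* Circle, ‖∑ᶠ t, a' t * ((χ t : Circle) : ℂ)‖ :=
        Real.iSup_nonneg fun _ => norm_nonneg _
      simp only [ha1] at h1
      have h4 : κ₀ * ⨆ χ : G →* Circle, ‖∑ᶠ t, a' t * ((χ t : Circle) : ℂ)‖ ≤ κ * (2 * B) :=
        mul_le_mul (le_max_left _ _) h2 h3 (by linarith)
      linarith
    have hτ : ∀ s t : E, τ s * τ t ≠ 1 := fun s t => hEd s s.2 t t.2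
    have hτ1 : ∀ t : E, τ t ≠ 1 := fun t h => hτ t t (by rw [h, one_mul])
    choose ζ hζ using fun t : E => fz_phase (a t)
    obtain ⟨S, hS1, hSt, hSp⟩ := fz_key τ Subtype.val_injective hτ hκ1 hS (ε := k / 4)
      (by positivity) (by linarith) (fun t => (ζ t)⁻¹)
    have hpos' : ∀ χ : G →* Circle, 0 ≤ (c + ∑ t : E, 2 * a t * (χ (τ t) : ℂ)).re := by
      intro χ
      have := hpos χ
      rw [fz_split E hEd (fun t => a t * (χ t : ℂ)) (fun g hg => hE g (left_ne_zero_of_mul hg)),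
        hherm2 E a hh, Complex.add_re, Complex.ofReal_re, Complex.ofReal_re] at this
      have e : ∑ t : E, 2 * a t * (χ (τ t) : ℂ) = (2 : ℝ) * ∑ t : E, a t * (χ t : ℂ) := by
        rw [Finset.mul_sum]
        exact Finset.sum_congr rfl fun t _ => by push_cast; ring
      rw [e, Complex.add_re, Complex.ofReal_re, Complex.re_ofReal_mul]
      exact this
    have hc0 : 0 ≤ c := fz_c_nonneg τ hτ1 c _ hpos'
    have hfin := hSp c (fun t => 2 * a t) hpos'
    set A := ∑ t : E, ‖a t‖ with hA
    have hmain : A * k ^ 2 / 8 ≤ 2 * c := by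
      rw [Complex.add_re, Complex.re_ofReal_mul, Complex.re_sum] at hfin
      have h1 : c * (S 1).re ≤ 2 * c := by
        have := (Complex.re_le_norm (S 1)).trans hS1
        nlinarith
      have h2 : ∑ t : E, (2 * a t * S (τ t)).re ≤ ∑ t : E, -(k ^ 2 / 8) * ‖a t‖ := by
        refine Finset.sum_le_sum fun t _ => ?_
        have ht := hSt t
        rw [inv_inv] at ht
        set r := S (τ t) - ((k / 4 : ℝ) : ℂ) / 2 * (1 / κ) ^ 2 * (ζ t : ℂ) with hr
        have hkc : (1 / (κ : ℂ)) ^ 2 = (k : ℂ) := by rw [hk]; push_cast; ring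
        have e : 2 * a t * S (τ t) = ((-(k ^ 2 / 4) * ‖a t‖ : ℝ) : ℂ) + 2 * (a t * r) := by
          have : S (τ t) = r + ((k / 4 : ℝ) : ℂ) / 2 * k * (ζ t : ℂ) := by rw [hr, hkc]; ring
          rw [this]
          push_cast
          linear_combination (k : ℂ) ^ 2 / 4 * hζ t
        have h3 : (2 * (a t * r)).re ≤ 2 * (‖a t‖ * (k / 4) ^ 2) := by
          refine (Complex.re_le_norm _).trans ?_
          rw [norm_mul, norm_mul, Complex.norm_ofNat]
          have := mul_le_mul_of_nonneg_left ht (norm_nonneg (a t))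
          linarith
        rw [e, Complex.add_re, Complex.ofReal_re]
        nlinarith
      rw [← Finset.mul_sum, ← hA] at h2
      linarith
    rw [finsum_mem_eq_sum_of_subset (t := E) _ _ hE1]
    · rw [Complex.add_re, Complex.ofReal_re, Complex.re_ofReal_mul]
      have h5 : ‖∑ t ∈ E, (a t * ((z t : Circle) : ℂ) + a t⁻¹ * starRingEnd ℂ ((z t : Circle) : ℂ))‖
          ≤ 2 * A := by
        refine (norm_sum_le _ _).trans ?_
        rw [hA, Finset.mul_sum, Finset.sum_coe_sort E (fun t => 2 * ‖a t‖)]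
        refine Finset.sum_le_sum fun t _ => ?_
        refine (norm_add_le _ _).trans (le_of_eq ?_)
        rw [norm_mul, norm_mul, hh, RCLike.norm_conj, RCLike.norm_conj, Circle.norm_coe]; ring
      have h6 := (abs_le.1 ((Complex.abs_re_le_norm _).trans h5)).1
      have h7 := mul_le_mul_of_nonneg_left h6 (show (0:ℝ) ≤ k ^ 2 / 32 by positivity)
      linarith
    · rintro g ⟨hg, hg2⟩
      by_contra hgE
      have hgi : g⁻¹ ∉ E := fun h => hdis g hg _ (hE1 h) (mul_inv_cancel g)
      have h0 : a g = 0 := by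
        by_contra h
        rcases hE g h with h | h
        · exact hgE h
        · exact hgi h
      exact hg2 (by simp [hh, h0])
  · rintro ⟨δ, hδ, hP⟩
    refine ⟨2 / δ, ?_⟩
    intro a hf hs
    obtain ⟨E, hE1, hE⟩ := hhalf a hf hs
    have hEd : ∀ s ∈ E, ∀ t ∈ E, s * t ≠ 1 := fun s hs t ht => hdis s (hE1 hs) t (hE1 ht)
    set M := ⨆ χ : G →* Circle, ‖∑ᶠ t, a t * ((χ t : Circle) : ℂ)‖ with hM
    have hsplit : ∀ χ : G →* Circle, ∑ᶠ t, a t * ((χ t : Circle) : ℂ) =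
        ∑ t : E, (a t * (χ t : ℂ) + a (t : G)⁻¹ * (χ (t : G)⁻¹ : ℂ)) := fun χ =>
      fz_split E hEd (fun t => a t * (χ t : ℂ)) (fun g hg => hE g (left_ne_zero_of_mul hg))
    have hle : ∀ χ : G →* Circle, ‖∑ᶠ t, a t * ((χ t : Circle) : ℂ)‖ ≤ M := by
      refine fun χ => le_ciSup (f := fun χ : G →* Circle => ‖∑ᶠ t, a t * ((χ t : Circle) : ℂ)‖)
        ⟨∑ t : E, (‖a t‖ + ‖a (t : G)⁻¹‖), ?_⟩ χ
      rintro _ ⟨χ, rfl⟩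
      simp only [hsplit]
      refine (norm_sum_le _ _).trans (Finset.sum_le_sum fun t _ => ?_)
      refine (norm_add_le _ _).trans (le_of_eq ?_)
      rw [norm_mul, norm_mul, Circle.norm_coe, Circle.norm_coe, mul_one, mul_one]
    have key : ∀ h : G → ℂ, (∀ g, h g ≠ 0 → g ∈ E ∨ g⁻¹ ∈ E) →
        (∀ t : G, h t⁻¹ = starRingEnd ℂ (h t)) →
        (∀ χ : G →* Circle,
          |(∑ t : E, (h t * (χ t : ℂ) + h (t : G)⁻¹ * (χ (t : G)⁻¹ : ℂ))).re| ≤ M) →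
        δ * ∑ t : E, (‖h t‖ + ‖h (t : G)⁻¹‖) ≤ M := by
      intro h hhE hh hb
      have hfin : (Function.support h).Finite := by
        refine (E ∪ E.image (fun g => g⁻¹)).finite_toSet.subset ?_
        intro g hg
        rcases hhE g hg with h | h
        · simp [h]
        · simp only [Finset.coe_union, Finset.coe_image, Set.mem_union, Finset.mem_coe,
            Set.mem_image]
          exact Or.inr ⟨_, h, inv_inv g⟩
      have hsupp : Function.support h ⊆ Λ := by
        intro g hg
        rcases hhE g hg with h | h
        · exact hsub (hE1 h)
        · rw [← inv_inv g]; exact hinvΛ _ (hsub (hE1 h))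
      choose z hz using fun g : G => fz_phase (h g)
      have := hP M h hfin hsupp hh (fun χ => by
        rw [fz_split E hEd (fun t => h t * (χ t : ℂ))
          (fun g hg => hhE g (left_ne_zero_of_mul hg)), Complex.add_re, Complex.ofReal_re]
        have := (abs_le.1 (hb χ)).1
        linarith) z
      rw [finsum_mem_eq_sum_of_subset (t := E) _ _ hE1] at this
      · have e : ∑ t ∈ E, (h t * ((z t : Circle) : ℂ) + h t⁻¹ * starRingEnd ℂ ((z t : Circle) : ℂ))
            = ((-∑ t : E, (‖h t‖ + ‖h (t : G)⁻¹‖) : ℝ) : ℂ) := by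
          rw [Finset.sum_coe_sort E (fun t => ‖h t‖ + ‖h t⁻¹‖), ← Finset.sum_neg_distrib,
            Complex.ofReal_sum]
          refine Finset.sum_congr rfl fun t _ => ?_
          rw [hh, ← map_mul, hz, map_neg, Complex.conj_ofReal, RCLike.norm_conj]
          push_cast; ring
        rw [e, Complex.add_re, Complex.ofReal_re, Complex.re_ofReal_mul, Complex.ofReal_re] at this
        linarith
      · rintro g ⟨hg, hg2⟩
        by_contra hgE
        have hgi : g⁻¹ ∉ E := fun h => hdis g hg _ (hE1 h) (mul_inv_cancel g)
        have h0 : h g = 0 := by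
          by_contra h
          rcases hhE g h with h | h
          · exact hgE h
          · exact hgi h
        exact hg2 (by simp [hh, h0])
    let h1 : G → ℂ := fun g => (a g + starRingEnd ℂ (a g⁻¹)) / 2
    let h2 : G → ℂ := fun g => -Complex.I * ((a g - starRingEnd ℂ (a g⁻¹)) / 2)
    have hz : ∀ g, ¬ (g ∈ E ∨ g⁻¹ ∈ E) → a g = 0 ∧ a g⁻¹ = 0 := by
      intro g hg
      refine ⟨by_contra fun h => hg (hE g h), by_contra fun h => hg ?_⟩
      have := hE _ h
      rw [inv_inv] at this
      exact this.symm
    have k1 := key h1 (fun g hg => by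
      by_contra hcon
      obtain ⟨e1, e2⟩ := hz g hcon
      exact hg (by simp [h1, e1, e2])) (fun t => by
        simp only [h1, inv_inv, map_add, map_div₀, Complex.conj_conj, map_ofNat]
        ring) (fun χ => by
        refine le_trans (le_of_eq ?_) ((Complex.abs_re_le_norm _).trans (hle χ))
        rw [hsplit]
        congr 1
        rw [Complex.re_sum, Complex.re_sum]
        refine Finset.sum_congr rfl fun t _ => ?_
        rw [hconj]
        simp [h1]
        ring)
    have k2 := key h2 (fun g hg => by
      by_contra hcon
      obtain ⟨e1, e2⟩ := hz g hcon
      exact hg (by simp [h2, e1, e2])) (fun t => by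
        simp only [h2, inv_inv, map_mul, map_neg, Complex.conj_I, map_div₀, map_sub,
          Complex.conj_conj, map_ofNat]
        ring) (fun χ => by
        refine le_trans (le_of_eq ?_) ((Complex.abs_im_le_norm _).trans (hle χ))
        rw [hsplit]
        congr 1
        rw [Complex.re_sum, Complex.im_sum]
        refine Finset.sum_congr rfl fun t _ => ?_
        rw [hconj]
        simp [h2]
        ring)
    have hn : ∀ g, ‖a g‖ ≤ ‖h1 g‖ + ‖h2 g‖ := by
      intro g
      have e : a g = h1 g + Complex.I * h2 g := by
        simp only [h1, h2]
        linear_combination ((a g - starRingEnd ℂ (a g⁻¹)) / 2) * Complex.I_sq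
      calc ‖a g‖ = ‖h1 g + Complex.I * h2 g‖ := by rw [← e]
        _ ≤ _ := (norm_add_le _ _).trans (by simp)
    rw [fz_split E hEd (fun t => ‖a t‖) (fun g hg => hE g (by simpa using hg))]
    have h3 : ∑ t : E, (‖a t‖ + ‖a (t : G)⁻¹‖) ≤ ∑ t : E, (‖h1 t‖ + ‖h1 (t : G)⁻¹‖) +
        ∑ t : E, (‖h2 t‖ + ‖h2 (t : G)⁻¹‖) := by
      rw [← Finset.sum_add_distrib]
      refine Finset.sum_le_sum fun t _ => ?_
      linarith [hn t, hn (t : G)⁻¹]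
    rw [div_mul_eq_mul_div, le_div_iff₀ hδ]
    have := mul_le_mul_of_nonneg_right h3 hδ.le
    linarith
end
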